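/- arXiv:2411.02377 — 3 statements merged into one kernel-verified Lean document; each statement's English description precedes it below -/
import Mathlib

section
/- In every two-sided matching market, starting from any matching μ, every sequence of the acceptor best-response dynamics is finite and terminates at a stable matching. -/
open scoped ENNReal Classical

noncomputable section

/-- A two-sided matching market: proposers `P`, acceptors `A`, and injective
utility functions with values in `[0,1)` assigning `0` to being unmatched. -/
structure Market (P A : Type) where
  uP : P → Option A → ℝ
  uA : A → Option P → ℝ
  uP_inj : ∀ i, Function.Injective (uP i)
  uA_inj : ∀ j, Function.Injective (uA j)
  uP_mem : ∀ i o, uP i o ∈ Set.Ico (0 : ℝ) 1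
  uA_mem : ∀ j o, uA j o ∈ Set.Ico (0 : ℝ) 1
  uP_none : ∀ i, uP i none = 0
  uA_none : ∀ j, uA j none = 0

/-- A (pre-)matching / action profile: each proposer points to an optional acceptor and
each acceptor points to an optional proposer. -/
abbrev Profile (P A : Type) := (P → Option A) × (A → Option P)

variable {P A : Type}

/-- The partner of proposer `i` in the matching induced by the action profile `a`
(reciprocated choices only). -/
def matchedP (a : Profile P A) (i : P) : Option A :=
  match a.1 i with
  | some j => if a.2 j = some i then some j else none
  | none => none

/-- The partner of acceptor `j` in the matching induced by the action profile `a`. -/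
def matchedA (a : Profile P A) (j : A) : Option P :=
  match a.2 j with
  | some i => if a.1 i = some j then some i else none
  | none => none

/-- The matching induced by an action profile. -/
def induced (a : Profile P A) : Profile P A := (matchedP a, matchedA a)

/-- A profile is a genuine matching when the two partner functions are mutually consistent. -/
def Consistent (μ : Profile P A) : Prop := ∀ i j, μ.1 i = some j ↔ μ.2 j = some i

/-- `(i, j)` is a blocking pair for the matching `μ`. -/
def Blocking (M : Market P A) (μ : Profile P A) (i : P) (j : A) : Prop :=
  M.uP i (μ.1 i) < M.uP i (some j) ∧ M.uA j (μ.2 j) < M.uA j (some i)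

/-- A matching is stable when it admits no blocking pair. -/
def Stable (M : Market P A) (μ : Profile P A) : Prop := ∀ i j, ¬ Blocking M μ i j

/-- Utility received by proposer `i` under the action profile `a`. -/
def utilP (M : Market P A) (a : Profile P A) (i : P) : ℝ := M.uP i (matchedP a i)

/-- Utility received by acceptor `j` under the action profile `a`. -/
def utilA (M : Market P A) (a : Profile P A) (j : A) : ℝ := M.uA j (matchedA a j)

/-- The set of proposers proposing to acceptor `j` under proposer actions `ap`. -/
def proposals [Fintype P] (ap : P → Option A) (j : A) : Finset P :=
  Finset.univ.filter fun i => ap i = some j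

/-- `μ'` is obtained from `μ` by resolving the blocking pair `(i, j)`: `i` and `j`
become matched with one another and their previous partners, if any, become unmatched. -/
def ResolvedFrom (μ : Profile P A) (i : P) (j : A) (μ' : Profile P A) : Prop :=
  μ'.1 i = some j ∧ μ'.2 j = some i ∧
  (∀ i', i' ≠ i → μ'.1 i' = if μ.1 i' = some j then none else μ.1 i') ∧
  (∀ j', j' ≠ j → μ'.2 j' = if μ.2 j' = some i then none else μ.2 j')

/-- One round of the acceptor best-response dynamics: a blocking pair `(i, j)` is
resolved, where blocking pairs with a matched acceptor have priority over those with an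
unmatched acceptor, and the resolving acceptor resolves the blocking pair yielding it the
highest utility among its own blocking pairs. -/
def ABRDStep (M : Market P A) (μ μ' : Profile P A) : Prop :=
  ∃ i j, Blocking M μ i j ∧
    ((∃ i' j', Blocking M μ i' j' ∧ μ.2 j' ≠ none) → μ.2 j ≠ none) ∧
    (∀ i', Blocking M μ i' j → M.uA j (some i') ≤ M.uA j (some i)) ∧
    ResolvedFrom μ i j μ'

/-- Resolving a blocking pair turns a matching into a matching. -/
theorem ResolvedFrom.consistent {μ μ' : Profile P A} {i : P} {j : A}
    (h : ResolvedFrom μ i j μ') (hμ : Consistent μ) : Consistent μ' := by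
  obtain ⟨h1, h2, h3, h4⟩ := h
  intro x y
  have hxy := hμ x y
  have hxj := hμ x j
  have hiy := hμ i y
  grind

/-- Some matched acceptor belongs to a blocking pair. -/
def MatchedBlocking (M : Market P A) (μ : Profile P A) : Prop :=
  ∃ i j, Blocking M μ i j ∧ μ.2 j ≠ none

/-- Potential of the first phase: total acceptor utility, an unmatched acceptor counting
for more than any matched one. -/
def acceptorPotential [Fintype A] (M : Market P A) (μ : Profile P A) : ℝ :=
  ∑ j, if μ.2 j = none then 1 else M.uA j (μ.2 j)

/-- Potential of the second phase: total proposer utility. -/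
def proposerPotential [Fintype P] (M : Market P A) (μ : Profile P A) : ℝ :=
  ∑ i, M.uP i (μ.1 i)

theorem ABRDStep.acceptorPotential_lt [Fintype A] {M : Market P A} {μ μ' : Profile P A}
    (h : ABRDStep M μ μ') (hm : MatchedBlocking M μ) :
    acceptorPotential M μ < acceptorPotential M μ' := by
  obtain ⟨i, j, hb, hprio, -, -, h2, -, h4⟩ := h
  have hj := hprio hm
  refine Finset.sum_lt_sum (fun y _ => ?_) ⟨j, Finset.mem_univ j, ?_⟩
  · by_cases hy : y = j
    · subst hy
      simpa [hj, h2] using hb.2.le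
    · rw [h4 y hy]
      by_cases hc : μ.2 y = some i
      · simpa [hc] using (M.uA_mem y (some i)).2.le
      · simp [hc]
  · simpa [hj, h2] using hb.2

/-- In the second phase the resolving acceptor is unmatched, so no proposer loses a partner. -/
theorem ABRDStep.exists_update {M : Market P A} {μ μ' : Profile P A}
    (h : ABRDStep M μ μ') (hμ : Consistent μ) (hm : ¬ MatchedBlocking M μ) :
    ∃ i j, Blocking M μ i j ∧ (∀ i', Blocking M μ i' j → M.uA j (some i') ≤ M.uA j (some i)) ∧
      μ'.1 i = some j ∧ (∀ x, x ≠ i → μ'.1 x = μ.1 x) ∧ μ.2 j = none ∧ μ'.2 j = some i ∧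
      ∀ y, y ≠ j → μ'.2 y = if μ.2 y = some i then none else μ.2 y := by
  obtain ⟨i, j, hb, -, hbest, h1, h2, h3, h4⟩ := h
  have hj : μ.2 j = none := by
    by_contra hj
    exact hm ⟨i, j, hb, hj⟩
  refine ⟨i, j, hb, hbest, h1, fun x hx => ?_, hj, h2, h4⟩
  rw [h3 x hx, if_neg]
  simp [hμ x j, hj]

theorem ABRDStep.proposerPotential_lt [Fintype P] {M : Market P A} {μ μ' : Profile P A}
    (h : ABRDStep M μ μ') (hμ : Consistent μ) (hm : ¬ MatchedBlocking M μ) :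
    proposerPotential M μ < proposerPotential M μ' := by
  obtain ⟨i, j, hb, -, h1, h3, -⟩ := h.exists_update hμ hm
  refine Finset.sum_lt_sum (fun x _ => ?_) ⟨i, Finset.mem_univ i, ?_⟩
  · by_cases hx : x = i
    · subst hx
      rw [h1]
      exact hb.1.le
    · rw [h3 x hx]
  · rw [h1]
    exact hb.1

/-- Once the second phase is reached, it is never left. -/
theorem ABRDStep.not_matchedBlocking {M : Market P A} {μ μ' : Profile P A}
    (h : ABRDStep M μ μ') (hμ : Consistent μ) (hm : ¬ MatchedBlocking M μ) :
    ¬ MatchedBlocking M μ' := by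
  obtain ⟨i, j, hb, hbest, h1, h3, hj, h2, h4⟩ := h.exists_update hμ hm
  have hmono : ∀ x, M.uP x (μ.1 x) ≤ M.uP x (μ'.1 x) := by
    intro x
    by_cases hx : x = i
    · subst hx
      rw [h1]
      exact hb.1.le
    · rw [h3 x hx]
  rintro ⟨x, y, hxy, hy⟩
  have hx := (hmono x).trans_lt hxy.1
  by_cases hyj : y = j
  · subst hyj
    have hlt := hxy.2
    rw [h2] at hlt
    exact (hbest x ⟨hx, hb.2.trans hlt⟩).not_gt hlt
  · have hμy : μ'.2 y = μ.2 y := by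
      rw [h4 y hyj] at hy ⊢
      split_ifs at hy ⊢ with hc
      · exact absurd rfl hy
      · rfl
    exact hm ⟨x, y, ⟨hx, hμy ▸ hxy.2⟩, hμy ▸ hy⟩

/-- A real-valued potential rules out infinite sequences in a finite state space. -/
theorem not_forall_lt_succ_of_finite {α : Type*} [Finite α] (f : ℕ → α) (φ : α → ℝ) :
    ¬ ∀ n, φ (f n) < φ (f (n + 1)) := fun h =>
  not_injective_infinite_finite f
    (Function.Injective.of_comp (f := φ) (strictMono_nat_of_lt_succ h).injective)

/-- An unstable matching admits a step of the dynamics. -/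
theorem exists_abrdStep_of_not_stable [Finite P] {M : Market P A} {μ : Profile P A}
    (h : ¬ Stable M μ) : ∃ ν, ABRDStep M μ ν := by
  obtain ⟨j, ⟨i₀, hi₀⟩, hprio⟩ : ∃ j, (∃ i, Blocking M μ i j) ∧
      (MatchedBlocking M μ → μ.2 j ≠ none) := by
    by_cases hm : MatchedBlocking M μ
    · obtain ⟨i, j, hb, hj⟩ := hm
      exact ⟨j, ⟨i, hb⟩, fun _ => hj⟩
    · simp only [Stable, not_forall, not_not] at h
      obtain ⟨i, j, hb⟩ := h
      exact ⟨j, ⟨i, hb⟩, fun h' => absurd h' hm⟩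
  obtain ⟨i, hi, hbest⟩ := Set.exists_max_image {i | Blocking M μ i j}
    (fun i => M.uA j (some i)) (Set.toFinite _) ⟨i₀, hi₀⟩
  refine ⟨(fun x => if x = i then some j else if μ.1 x = some j then none else μ.1 x,
    fun y => if y = j then some i else if μ.2 y = some i then none else μ.2 y),
    i, j, hi, hprio, hbest, by simp, by simp, fun x hx => by simp [hx], fun y hy => by simp [hy]⟩

/-- In every two-sided matching market, starting from any matching, every
sequence of the acceptor best-response dynamics is finite, and every maximal finite
sequence terminates at a stable matching. -/
theorem statement9 [Fintype P] [Fintype A] (M : Market P A)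
    (μ : Profile P A) (hμ : Consistent μ) :
    (¬ ∃ f : ℕ → Profile P A, f 0 = μ ∧ ∀ n, ABRDStep M (f n) (f (n + 1))) ∧
    (∀ (n : ℕ) (f : ℕ → Profile P A), f 0 = μ →
      (∀ i < n, ABRDStep M (f i) (f (i + 1))) →
      (∀ ν, ¬ ABRDStep M (f n) ν) → Stable M (f n)) := by
  refine ⟨?_, fun n f _ _ hend => ?_⟩
  · rintro ⟨f, h0, hstep⟩
    have hcons : ∀ n, Consistent (f n) := by
      intro n
      induction n with
      | zero => exact h0 ▸ hμ
      | succ n ih =>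
        obtain ⟨i, j, -, -, -, hr⟩ := hstep n
        exact hr.consistent ih
    by_cases hm : ∀ n, MatchedBlocking M (f n)
    · exact not_forall_lt_succ_of_finite f (acceptorPotential M)
        fun n => (hstep n).acceptorPotential_lt (hm n)
    · obtain ⟨N, hN⟩ := not_forall.mp hm
      have hphase : ∀ k, ¬ MatchedBlocking M (f (N + k)) := by
        intro k
        induction k with
        | zero => exact hN
        | succ k ih => exact (hstep (N + k)).not_matchedBlocking (hcons _) ih
      exact not_forall_lt_succ_of_finite (fun k => f (N + k)) (proposerPotential M)
        fun k => (hstep (N + k)).proposerPotential_lt (hcons _) (hphase k)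
  · by_contra hns
    obtain ⟨ν, hν⟩ := exists_abrdStep_of_not_stable hns
    exact hend ν hν

end
end

section
/- Let X be a finite set, let w : X × X → [0, ∞] be edge weights of a directed graph on X, let T be a spanning in-tree rooted at x ∈ X, and let z ∈ X with z ≠ x and w(x, z) < ∞. Let e_z denote the unique outgoing edge of z in T. Then the edge set T' = (T \ {e_z}) ∪ {(x, z)} is a spanning in-tree rooted at z, and its weight equals w(T) − w(e_z) + w(x, z). -/
open scoped ENNReal Classical

noncomputable section

/-- The weight of a set of edges in a weighted directed graph on `X` with edge
weights `w : X × X → [0, ∞]`. -/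
def treeWeight {X : Type} (w : X × X → ℝ≥0∞) (T : Set (X × X)) : ℝ≥0∞ :=
  ∑' e : T, w e

/-- `T` is a spanning in-tree rooted at `root`: a set of present edges (an edge is present
iff its weight is finite) such that every node other than the root has exactly one outgoing
edge in `T`, the root has none, and from every node there is a directed path in `T` to the
root. -/
def IsInTree {X : Type} (w : X × X → ℝ≥0∞) (root : X) (T : Set (X × X)) : Prop :=
  (∀ e ∈ T, w e ≠ ⊤) ∧
  (∀ x, x ≠ root → ∃! y, (x, y) ∈ T) ∧
  (∀ y, (root, y) ∉ T) ∧
  (∀ x, ∃ (n : ℕ) (p : ℕ → X), p 0 = x ∧ p n = root ∧ ∀ i < n, (p i, p (i + 1)) ∈ T)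

theorem exists_path_iff_reflTransGen {X : Type*} (r : X → X → Prop) (a b : X) :
    (∃ (n : ℕ) (p : ℕ → X), p 0 = a ∧ p n = b ∧ ∀ i < n, r (p i) (p (i + 1))) ↔
      Relation.ReflTransGen r a b := by
  constructor
  · rintro ⟨n, p, rfl, rfl, h⟩
    induction n with
    | zero => exact .refl
    | succ n ih => exact (ih fun i hi => h i (by omega)).tail (h n n.lt_succ_self)
  · intro h
    induction h using Relation.ReflTransGen.head_induction_on with
    | refl => exact ⟨0, fun _ => b, rfl, rfl, by simp⟩
    | @head a c hac _ ih =>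
      obtain ⟨n, p, h0, hn, hp⟩ := ih
      refine ⟨n + 1, fun i => Nat.casesOn i a p, rfl, hn, ?_⟩
      rintro (_ | i) hi
      · simpa [h0] using hac
      · exact hp i (by omega)

theorem treeWeight_union_singleton {X : Type} (w : X × X → ℝ≥0∞) {S : Set (X × X)}
    {e : X × X} (he : e ∉ S) : treeWeight w (S ∪ {e}) = treeWeight w S + w e := by
  unfold treeWeight
  rw [ENNReal.summable.tsum_union_disjoint (Set.disjoint_singleton_right.2 he)
    ENNReal.summable, tsum_singleton]

/-- If `T` is a spanning in-tree rooted at `x`, `z ≠ x` with the edge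
`(x, z)` present, and `e` is the unique outgoing edge of `z` in `T`, then
`(T \ {e}) ∪ {(x, z)}` is a spanning in-tree rooted at `z` whose weight is
`w(T) - w(e) + w(x, z)`. -/
theorem statement13 {X : Type} [Finite X] (w : X × X → ℝ≥0∞) (x z : X)
    (T : Set (X × X)) (hT : IsInTree w x T) (hzx : z ≠ x) (hxz : w (x, z) < ⊤)
    (e : X × X) (he : e ∈ T) (he1 : e.1 = z) :
    IsInTree w z ((T \ {e}) ∪ {(x, z)}) ∧
    treeWeight w ((T \ {e}) ∪ {(x, z)}) = treeWeight w T - w e + w (x, z) := by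
  obtain ⟨hw, hout, hroot, hpath⟩ := hT
  obtain ⟨u, y⟩ := e
  obtain rfl : u = z := he1
  refine ⟨⟨?_, ?_, ?_, ?_⟩, ?_⟩
  · rintro f (hf | rfl)
    · exact hw f hf.1
    · exact hxz.ne
  · intro a ha
    by_cases hax : a = x
    · subst hax
      refine ⟨_, Or.inr rfl, ?_⟩
      rintro b (hb | hb)
      · exact (hroot b hb.1).elim
      · exact congrArg Prod.snd hb
    · obtain ⟨b, hb, hub⟩ := hout a hax
      refine ⟨b, Or.inl ⟨hb, fun h => ha (congrArg Prod.fst h)⟩, ?_⟩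
      rintro c (hc | hc)
      · exact hub c hc.1
      · exact (hax (congrArg Prod.fst hc)).elim
  · rintro b (hb | hb)
    · exact hb.2 (congrArg (Prod.mk _) ((hout _ hzx).unique hb.1 he))
    · exact hzx (congrArg Prod.fst hb)
  · intro a
    rw [exists_path_iff_reflTransGen (fun a b => (a, b) ∈ _)]
    have h := (exists_path_iff_reflTransGen (fun a b => (a, b) ∈ T) a x).1 (hpath a)
    induction h using Relation.ReflTransGen.head_induction_on with
    | refl => exact .single (Or.inr rfl)
    | @head a c hac _ ih =>
      by_cases hae : (a, c) = (u, y)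
      · rw [show a = u from congrArg Prod.fst hae]
      · exact ih.head (Or.inl ⟨hac, hae⟩)
  · rw [treeWeight_union_singleton w fun h => hroot _ h.1]
    congr 1
    conv_rhs => rw [← Set.sdiff_union_of_subset (Set.singleton_subset_iff.2 he)]
    rw [treeWeight_union_singleton w fun h => h.2 rfl, ENNReal.add_sub_cancel_right (hw _ he)]

end
end

section
/- Let X be a finite set with a weighted directed graph given by w : X × X → [0, ∞], let T be a spanning in-tree rooted at z⁰ ∈ X, and let z⁰, z¹, …, z^k be a directed path of present edges with the nodes z⁰, …, z^k pairwise distinct and k ≥ 1. Then the edge set obtained from T by deleting the unique outgoing edge in T of each of z¹, …, z^k and adding the path edges (z⁰, z¹), (z¹, z²), …, (z^{k−1}, z^k) is a spanning in-tree rooted at z^k. -/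
open scoped ENNReal Classical

noncomputable section

/-- A sequence of edges in `S` ending at `root` can be extended by an initial edge in `S`. -/
theorem exists_path_of_edge {X : Type} {S : Set (X × X)} {root x y : X} (hxy : (x, y) ∈ S)
    (hy : ∃ (n : ℕ) (q : ℕ → X), q 0 = y ∧ q n = root ∧ ∀ i < n, (q i, q (i + 1)) ∈ S) :
    ∃ (n : ℕ) (q : ℕ → X), q 0 = x ∧ q n = root ∧ ∀ i < n, (q i, q (i + 1)) ∈ S := by
  obtain ⟨n, q, h0, hn, hq⟩ := hy
  refine ⟨n + 1, fun i => Nat.casesOn i x q, rfl, hn, fun i hi => ?_⟩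
  cases i with
  | zero => simpa [h0] using hxy
  | succ i => exact hq i (by omega)

/-- If `T` is a spanning in-tree rooted at `z⁰ = p 0` and
`p 0, p 1, …, p k` is a directed path of present edges with pairwise distinct nodes and
`k ≥ 1`, then deleting from `T` the unique outgoing edge of each of `p 1, …, p k` and
adding the path edges yields a spanning in-tree rooted at `p k`. -/
theorem statement14 {X : Type} [Finite X] (w : X × X → ℝ≥0∞) (k : ℕ) (hk : 1 ≤ k)
    (p : ℕ → X) (T : Set (X × X)) (hT : IsInTree w (p 0) T)
    (hinj : ∀ i ≤ k, ∀ j ≤ k, p i = p j → i = j)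
    (hpres : ∀ i < k, w (p i, p (i + 1)) < ⊤) :
    IsInTree w (p k)
      (({e ∈ T | ∀ i, 1 ≤ i → i ≤ k → e.1 ≠ p i}) ∪
        {e | ∃ i < k, e = (p i, p (i + 1))}) := by
  obtain ⟨hfin, huniq, hroot, hpath⟩ := hT
  refine ⟨?_, ?_, ?_, ?_⟩
  · rintro e (⟨he, -⟩ | ⟨i, hi, rfl⟩)
    · exact hfin e he
    · exact (hpres i hi).ne
  · intro x hx
    by_cases hxp : ∃ i ≤ k, x = p i
    · obtain ⟨i, hi, rfl⟩ := hxp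
      have hik : i < k := lt_of_le_of_ne hi fun h => hx (h ▸ rfl)
      refine ⟨p (i + 1), Or.inr ⟨i, hik, rfl⟩, ?_⟩
      rintro y (⟨hy, hy'⟩ | ⟨j, hj, hy⟩)
      · rcases Nat.eq_zero_or_pos i with rfl | hpos
        · exact absurd hy (hroot y)
        · exact absurd rfl (hy' i hpos hi)
      · obtain ⟨hij, rfl⟩ := Prod.mk.inj hy
        rw [hinj i hi j hj.le hij]
    · push Not at hxp
      obtain ⟨y, hy, hyu⟩ := huniq x (hxp 0 (Nat.zero_le k))
      refine ⟨y, Or.inl ⟨hy, fun i _ hi => hxp i hi⟩, ?_⟩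
      rintro z (⟨hz, -⟩ | ⟨j, hj, hz⟩)
      · exact hyu z hz
      · exact absurd (Prod.mk.inj hz).1 (hxp j hj.le)
  · rintro y (⟨-, hy⟩ | ⟨j, hj, hy⟩)
    · exact hy k hk le_rfl rfl
    · exact hj.ne' (hinj k le_rfl j hj.le (Prod.mk.inj hy).1)
  · intro x
    obtain ⟨n, q, h0, hn, hq⟩ := hpath x
    induction n generalizing x q with
    | zero =>
      exact ⟨k, p, hn.symm.trans h0, rfl, fun i hi => Or.inr ⟨i, hi, rfl⟩⟩
    | succ n ih =>
      by_cases hxp : ∃ i ≤ k, x = p i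
      · obtain ⟨i, hi, rfl⟩ := hxp
        exact ⟨k - i, fun j => p (i + j), rfl, congrArg p (by omega),
          fun j hj => Or.inr ⟨i + j, by omega, rfl⟩⟩
      · push Not at hxp
        refine exists_path_of_edge (y := q 1) (Or.inl ⟨?_, fun i _ hi => hxp i hi⟩)
          (ih (q 1) (fun i => q (i + 1)) rfl hn fun i hi => hq (i + 1) (by omega))
        simpa [h0] using hq 0 (Nat.succ_pos n)

end
end
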